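/- Let B = (b_n) be a sequence of natural numbers with b_n > 4·(b_1 + ⋯ + b_{n−1}) for all n. Then the representation of elements of Δ(B) − Δ(B) is rigid: if (b_{r₁} − b_{r₂}) − (b_{r₃} − b_{r₄}) = (b_{t₁} − b_{t₂}) − (b_{t₃} − b_{t₄}) with r₁ > r₂ > r₃ > r₄ and t₁ > t₂ > t₃ > t₄, then r₁ = t₁, {r₂, r₃} = {t₂, t₃}, and r₄ = t₄. -/

import Mathlib

theorem rigid_representation (b : ℕ → ℕ)
    (hgrow : ∀ n : ℕ, (4 : ℕ) * ∑ i ∈ Finset.range n, b i < b n)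
    (r₁ r₂ r₃ r₄ t₁ t₂ t₃ t₄ : ℕ)
    (hr : r₄ < r₃ ∧ r₃ < r₂ ∧ r₂ < r₁)
    (ht : t₄ < t₃ ∧ t₃ < t₂ ∧ t₂ < t₁)
    (heq : ((b r₁ : ℤ) - b r₂) - ((b r₃ : ℤ) - b r₄)
         = ((b t₁ : ℤ) - b t₂) - ((b t₃ : ℤ) - b t₄)) :
    r₁ = t₁ ∧ ({r₂, r₃} : Set ℕ) = {t₂, t₃} ∧ r₄ = t₄ := by
  have key : ∀ m n : ℕ, m < n → 4 * b m < b n := by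
    intro m n hmn
    have h1 : b m ≤ ∑ i ∈ Finset.range n, b i :=
      Finset.single_le_sum (f := b) (fun i _ => Nat.zero_le _) (Finset.mem_range.2 hmn)
    have h2 := hgrow n
    omega
  obtain ⟨hr1, hr2, hr3⟩ := hr
  obtain ⟨ht1, ht2, ht3⟩ := ht
  have a1 := key _ _ hr1
  have a2 := key _ _ hr2
  have a3 := key _ _ hr3
  have c1 := key _ _ ht1
  have c2 := key _ _ ht2
  have c3 := key _ _ ht3
  have e1 : r₁ = t₁ := by
    rcases lt_trichotomy r₁ t₁ with h | h | h
    · have := key _ _ h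
      omega
    · exact h
    · have := key _ _ h
      omega
  subst e1
  have e2 : r₂ = t₂ := by
    rcases lt_trichotomy r₂ t₂ with h | h | h
    · have := key _ _ h
      omega
    · exact h
    · have := key _ _ h
      omega
  subst e2
  have e3 : r₃ = t₃ := by
    rcases lt_trichotomy r₃ t₃ with h | h | h
    · have := key _ _ h
      omega
    · exact h
    · have := key _ _ h
      omega
  subst e3
  have e4 : r₄ = t₄ := by
    rcases lt_trichotomy r₄ t₄ with h | h | h
    · have := key _ _ h
      omega
    · exact h
    · have := key _ _ h
      omega
  exact ⟨rfl, rfl, e4⟩
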